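/- Any projective module over a local commutative ring is free. -/

import Mathlib

theorem kap_key {A P : Type*} [CommRing A] [IsLocalRing A] [AddCommGroup P] [Module A P]
    (h : Module.Projective A P) (q : P →ₗ[A] P) (hq : ∀ p, q (q p) = q p) (x : P)
    (hx : q x = x) :
    ∃ (n : ℕ) (y : Fin n → P) (ψ : Fin n → P →ₗ[A] A), (∀ i, q (y i) = y i) ∧
      (∀ i j, ψ j (y i) = if i = j then 1 else 0) ∧ x ∈ Submodule.span A (Set.range y) := by
  classical
  have hex : ∃ n : ℕ, ∃ (y : Fin n → P) (φ : Fin n → P →ₗ[A] A), (∀ i, q (y i) = y i) ∧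
      x = ∑ i, φ i x • y i := by
    obtain ⟨s, hs⟩ := h.out
    refine ⟨(s x).support.card, fun i => q ((s x).support.equivFin.symm i : P),
      fun i => Finsupp.lapply ((s x).support.equivFin.symm i : P) ∘ₗ s, fun i => hq _, ?_⟩
    have h1 := hs x
    rw [Finsupp.linearCombination_apply, Finsupp.sum] at h1
    have h2 := congrArg q h1
    rw [hx, map_sum, ← Finset.sum_coe_sort] at h2
    refine h2.symm.trans ?_
    refine Eq.trans ?_ ((s x).support.equivFin.symm.sum_comp
      (fun i => s x i • q (i : P))).symm
    exact Finset.sum_congr rfl fun i _ => by simp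
  obtain ⟨y, φ, hy, hsum⟩ := Nat.find_spec hex
  have hmin : ∀ m < Nat.find hex, _ := fun m hm => Nat.find_min hex hm
  generalize Nat.find hex = n at *
  -- minimality
  have hd : ∀ d : Fin n → A, ∑ i, φ i x * d i = 0 → ∀ k, d k ∈ IsLocalRing.maximalIdeal A := by
    intro d hd0 k
    by_contra hk
    have hu : IsUnit (d k) := by simpa using hk
    obtain ⟨u, hu⟩ := hu
    obtain _ | n := n
    · exact k.elim0
    apply hmin n (Nat.lt_succ_self n)
    rw [Fin.sum_univ_succAbove _ k] at hd0 hsum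
    have hak : φ k x = ∑ i, -(φ (k.succAbove i) x * d (k.succAbove i) * (↑u⁻¹ : A)) := by
      rw [Finset.sum_neg_distrib, ← Finset.sum_mul]
      have hu' : d k * (↑u⁻¹ : A) = 1 := by rw [← hu]; simp
      linear_combination (-φ k x) * hu' + (↑u⁻¹ : A) * hd0
    refine ⟨fun i => y (k.succAbove i) - (d (k.succAbove i) * (↑u⁻¹ : A)) • y k,
      fun i => φ (k.succAbove i), fun i => by simp [hy], ?_⟩
    conv_lhs => rw [hsum, hak]
    rw [Finset.sum_smul, ← Finset.sum_add_distrib]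
    refine Finset.sum_congr rfl fun i _ => ?_
    module
  let c : Matrix (Fin n) (Fin n) A := Matrix.of fun i j => φ j (y i)
  have hc : IsUnit c.det := by
    apply isUnit_of_map_unit (IsLocalRing.residue A)
    have : c.map (IsLocalRing.residue A) = 1 := by
      ext i j
      have := hd (fun i => φ j (y i) - if i = j then 1 else 0) (by
        have := congrArg (φ j) hsum
        rw [map_sum] at this
        simp only [mul_sub, Finset.sum_sub_distrib]
        simp at this ⊢
        rw [← this, sub_self]) i
      rw [← IsLocalRing.residue_eq_zero_iff, map_sub, sub_eq_zero] at this
      simp only [Matrix.map_apply, c, Matrix.of_apply, this, Matrix.one_apply]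
      split_ifs <;> simp
    rw [RingHom.map_det, RingHom.mapMatrix_apply, this, Matrix.det_one]
    exact isUnit_one
  refine ⟨n, y, fun j => ∑ k, c⁻¹ k j • φ k, hy, fun i j => ?_, ?_⟩
  · have := congrFun (congrFun (Matrix.mul_nonsing_inv c hc) i) j
    rw [Matrix.mul_apply, Matrix.one_apply] at this
    rw [← this]
    simp [c, mul_comm]
  · rw [hsum]
    exact Submodule.sum_mem _ fun i _ => Submodule.smul_mem _ _ (Submodule.subset_span ⟨i, rfl⟩)

def KapGood (A : Type*) {P : Type*} [CommRing A] [AddCommGroup P] [Module A P] (B : Set P) : Prop :=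
  LinearIndepOn A id B ∧ ∃ q : P →ₗ[A] P, (∀ b ∈ B, q b = 0) ∧
    ∀ p, p - q p ∈ Submodule.span A B

theorem kap_step {A P : Type*} [CommRing A] [IsLocalRing A] [AddCommGroup P] [Module A P]
    (h : Module.Projective A P) (B : Set P) (hB : KapGood A B) (x : P) :
    ∃ B', B ⊆ B' ∧ KapGood A B' ∧ (B' \ B).Finite ∧ x ∈ Submodule.span A B' := by
  classical
  obtain ⟨hli, q, hqB, hqp⟩ := hB
  have hqs : ∀ b ∈ Submodule.span A B, q b = 0 := fun b hb =>
    (Submodule.span_le (p := LinearMap.ker q)).2 hqB hb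
  have hq : ∀ p, q (q p) = q p := fun p => by
    have := hqs _ (hqp p)
    rw [map_sub, sub_eq_zero] at this
    exact this.symm
  obtain ⟨n, y, ψ, hy, hψ, hx⟩ := kap_key h q hq (q x) (hq x)
  have hyli : LinearIndependent A y := by
    rw [Fintype.linearIndependent_iff]
    intro g hg i
    simpa [hψ] using congrArg (ψ i) hg
  have hqy : ∀ v ∈ Submodule.span A (Set.range y), q v = v := fun v hv =>
    (Submodule.span_le (p := LinearMap.eqLocus q LinearMap.id)).2
      (by rintro _ ⟨i, rfl⟩; exact hy i) hv
  have hl : Submodule.span A B ≤ Submodule.span A (B ∪ Set.range y) :=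
    Submodule.span_mono Set.subset_union_left
  have hr : Submodule.span A (Set.range y) ≤ Submodule.span A (B ∪ Set.range y) :=
    Submodule.span_mono Set.subset_union_right
  refine ⟨B ∪ Set.range y, Set.subset_union_left, ⟨?_, ?_⟩, ?_, ?_⟩
  · apply LinearIndepOn.id_union hli hyli.linearIndepOn_id
    rw [Submodule.disjoint_def]
    intro v hv hv'
    rw [← hqy v hv', hqs v hv]
  · refine ⟨q - ∑ j, (LinearMap.toSpanSingleton A P (y j)) ∘ₗ ψ j ∘ₗ q, ?_, ?_⟩
    · rintro b (hb | ⟨i, rfl⟩)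
      · simp [hqB b hb]
      · simp [hy, hψ]
    · intro p
      have : p - (q - ∑ j, (LinearMap.toSpanSingleton A P (y j)) ∘ₗ ψ j ∘ₗ q) p =
        (p - q p) + ∑ j, ψ j (q p) • y j := by simp; abel
      rw [this]
      exact add_mem (hl (hqp p)) (hr (Submodule.sum_mem _ fun i _ =>
        Submodule.smul_mem _ _ (Submodule.subset_span ⟨i, rfl⟩)))
  · exact (Set.finite_range y).subset (by rintro v ⟨h1 | h1, h2⟩; exacts [absurd h1 h2, h1])
  · have := add_mem (hl (hqp x)) (hr hx)
    simpa using this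

theorem kap_steps {A P : Type*} [CommRing A] [IsLocalRing A] [AddCommGroup P] [Module A P]
    (h : Module.Projective A P) (B : Set P) (hB : KapGood A B) (X : Set P) (hX : X.Finite) :
    ∃ B', B ⊆ B' ∧ KapGood A B' ∧ (B' \ B).Finite ∧ X ⊆ Submodule.span A B' := by
  induction X, hX using Set.Finite.induction_on with
  | empty => exact ⟨B, le_rfl, hB, by simp, by simp⟩
  | @insert x X _ _ ih =>
    obtain ⟨B1, h1, h2, h3, h4⟩ := ih
    obtain ⟨B2, k1, k2, k3, k4⟩ := kap_step h B1 h2 x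
    refine ⟨B2, h1.trans k1, k2, (k3.union h3).subset ?_, ?_⟩
    · intro v hv
      by_cases hv1 : v ∈ B1
      · exact Or.inr ⟨hv1, hv.2⟩
      · exact Or.inl ⟨hv.1, hv1⟩
    · exact Set.insert_subset k4 (h4.trans (Submodule.span_mono k1))

def KapJ {A P : Type*} [CommRing A] [AddCommGroup P] [Module A P]
    (s : P →ₗ[A] (P →₀ A)) (B S : Set P) : Prop :=
  KapGood A B ∧ (∀ b ∈ B, ↑(s b).support ⊆ S) ∧
    ∃ T : Set P, T.Finite ∧ ∀ t ∈ S \ T, t ∈ Submodule.span A B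

theorem kap_J {A P : Type*} [CommRing A] [IsLocalRing A] [AddCommGroup P] [Module A P]
    (h : Module.Projective A P) (s : P →ₗ[A] (P →₀ A)) (B S : Set P) (hJ : KapJ s B S) :
    ∃ B' S', B ⊆ B' ∧ S ⊆ S' ∧ KapJ s B' S' ∧ S ⊆ Submodule.span A B' := by
  obtain ⟨hB, hS, T, hT, hTS⟩ := hJ
  obtain ⟨B', h1, h2, h3, h4⟩ := kap_steps h B hB T hT
  have h5 : S ⊆ Submodule.span A B' := fun t ht => by
    by_cases htT : t ∈ T
    · exact h4 htT
    · exact Submodule.span_mono h1 (hTS t ⟨ht, htT⟩)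
  refine ⟨B', S ∪ ⋃ b ∈ B' \ B, ↑(s b).support, h1, Set.subset_union_left,
    ⟨h2, ?_, ⋃ b ∈ B' \ B, ↑(s b).support, ?_, ?_⟩, h5⟩
  · intro b hb
    by_cases hbB : b ∈ B
    · exact (hS b hbB).trans Set.subset_union_left
    · exact (Set.subset_biUnion_of_mem (u := fun b => ((s b).support : Set P)) 
        (show b ∈ B' \ B from ⟨hb, hbB⟩)).trans Set.subset_union_right
  · exact h3.biUnion fun b _ => Finset.finite_toSet _
  · rintro t ⟨ht | ht, ht'⟩
    · exact h5 ht
    · exact absurd ht ht'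

theorem kap_extend {A P : Type*} [CommRing A] [IsLocalRing A] [AddCommGroup P] [Module A P]
    (h : Module.Projective A P) (s : P →ₗ[A] (P →₀ A)) (B S : Set P) (hJ : KapJ s B S) :
    ∃ B' S', B ⊆ B' ∧ S ⊆ S' ∧ LinearIndepOn A id B' ∧ (∀ b ∈ B', ↑(s b).support ⊆ S') ∧
      S' ⊆ Submodule.span A B' := by
  choose f g h1 h2 h3 h4 using kap_J h s
  let F : ℕ → {p : Set P × Set P // KapJ s p.1 p.2} := fun n =>
    Nat.rec ⟨(B, S), hJ⟩ (fun _ p => ⟨(f p.1.1 p.1.2 p.2, g p.1.1 p.1.2 p.2), h3 _ _ _⟩) n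
  have mB : Monotone fun n => (F n).1.1 := monotone_nat_of_le_succ fun n => h1 _ _ (F n).2
  have hSB : ∀ n, (F n).1.2 ⊆ Submodule.span A (F (n+1)).1.1 := fun n => h4 _ _ (F n).2
  refine ⟨⋃ n, (F n).1.1, ⋃ n, (F n).1.2, Set.subset_iUnion (fun n => (F n).1.1) 0,
    Set.subset_iUnion (fun n => (F n).1.2) 0, ?_, ?_, ?_⟩
  · exact linearIndepOn_iUnion_of_directed (mB.directed_le) fun n => (F n).2.1.1
  · intro b hb
    obtain ⟨n, hn⟩ := Set.mem_iUnion.1 hb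
    exact ((F n).2.2.1 b hn).trans (Set.subset_iUnion (fun n => (F n).1.2) n)
  · intro t ht
    obtain ⟨n, hn⟩ := Set.mem_iUnion.1 ht
    exact Submodule.span_mono (Set.subset_iUnion (fun n => (F n).1.1) (n+1)) (hSB n hn)

theorem kap_good {A P : Type*} [CommRing A] [AddCommGroup P] [Module A P]
    (s : P →ₗ[A] (P →₀ A)) (hs : Function.LeftInverse (Finsupp.linearCombination A id) s)
    (B S : Set P) (h1 : LinearIndepOn A id B) (h2 : ∀ b ∈ B, ↑(s b).support ⊆ S)
    (h3 : S ⊆ Submodule.span A B) : KapGood A B := by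
  classical
  refine ⟨h1, Finsupp.linearCombination A (fun t : P => if t ∈ S then 0 else t) ∘ₗ s, ?_, ?_⟩
  · intro b hb
    rw [LinearMap.comp_apply, Finsupp.linearCombination_apply, Finsupp.sum]
    exact Finset.sum_eq_zero fun t ht => by rw [if_pos (h2 b hb ht), smul_zero]
  · intro p
    nth_rw 1 [← hs p]
    rw [LinearMap.comp_apply, Finsupp.linearCombination_apply, Finsupp.linearCombination_apply,
      Finsupp.sum, Finsupp.sum, ← Finset.sum_sub_distrib]
    refine Submodule.sum_mem _ fun t _ => ?_
    rw [← smul_sub]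
    refine Submodule.smul_mem _ _ ?_
    split_ifs with ht
    · simpa using h3 ht
    · simp

/-- Any projective module over a local commutative ring is free. -/
theorem projective_over_local_is_free
    (A P : Type*) [CommRing A] [IsLocalRing A] [AddCommGroup P] [Module A P]
    (h : Module.Projective A P) :
    Module.Free A P := by
  obtain ⟨s, hs⟩ := h.out
  obtain ⟨⟨B, S⟩, hm⟩ := zorn_le₀ {p : Set P × Set P | LinearIndepOn A id p.1 ∧
      (∀ b ∈ p.1, ↑(s b).support ⊆ p.2) ∧ p.2 ⊆ Submodule.span A p.1} (by
    intro c hc hch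
    refine ⟨(⋃ p ∈ c, p.1, ⋃ p ∈ c, p.2), ⟨?_, ?_, ?_⟩, ?_⟩
    · rw [Set.biUnion_eq_iUnion]
      refine linearIndepOn_iUnion_of_directed ?_ fun p => (hc p.2).1
      intro p r
      rcases hch.total p.2 r.2 with hh | hh
      · exact ⟨r, hh.1, le_rfl⟩
      · exact ⟨p, le_rfl, hh.1⟩
    · intro b hb
      obtain ⟨p, hp, hb⟩ := Set.mem_iUnion₂.1 hb
      intro t ht
      exact Set.mem_iUnion₂.2 ⟨p, hp, (hc hp).2.1 b hb ht⟩
    · intro t ht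
      obtain ⟨p, hp, ht⟩ := Set.mem_iUnion₂.1 ht
      have hle : p.1 ⊆ ⋃ p ∈ c, p.1 := fun v hv => Set.mem_iUnion₂.2 ⟨p, hp, hv⟩
      exact Submodule.span_mono hle ((hc hp).2.2 ht)
    · intro p hp
      exact ⟨fun v hv => Set.mem_iUnion₂.2 ⟨p, hp, hv⟩,
        fun v hv => Set.mem_iUnion₂.2 ⟨p, hp, hv⟩⟩)
  obtain ⟨h1, h2, h3⟩ := hm.prop
  have hS : ∀ t, t ∈ S := by
    intro t
    obtain ⟨B', S', k1, k2, k3⟩ := kap_extend h s B (insert t S)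
      ⟨kap_good s hs B S h1 h2 h3, fun b hb => (h2 b hb).trans (Set.subset_insert _ _),
        {t}, Set.finite_singleton t, fun r hr => h3 (hr.1.resolve_left hr.2)⟩
    have := hm.le_of_ge (y := (B', S')) k3 ⟨k1, (Set.subset_insert _ _).trans k2⟩
    exact this.2 (k2 (Set.mem_insert _ _))
  exact Module.Free.of_basis (Module.Basis.mk (v := fun b : B => (b : P)) h1
    (by rw [Subtype.range_coe]; exact fun t _ => h3 (hS t)))
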